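/- arXiv:1203.5718 — 2 statements merged into one kernel-verified Lean document; each statement's English description precedes it below -/
import Mathlib

section
/- Let R be a commutative ring. Let P be a cochain complex of projective R-modules concentrated in degrees [0, d] for some d ≥ 0 (that is, Pⁱ = 0 for i < 0 and for i > d), and let Q be a bounded-above cochain complex of projective R-modules. Suppose that there exists a quasi-isomorphism P → Q or a quasi-isomorphism Q → P. Then Hⁱ(Q) = 0 for all i < 0, the cokernel of the differential d_Q^{−1} : Q^{−1} → Q⁰ is a projective R-module, and the complex Q′ = [coker(d_Q^{−1}) → Q¹ → Q² → ⋯] (concentrated in degrees ≥ 0, with the maps induced by the differentials of Q) together with the canonical projection Q → Q′ is quasi-isomorphic to Q. -/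
open CategoryTheory Limits

universe u v

lemma projective_coker_aux {R : Type u} [CommRing R] {P Q : CochainComplex (ModuleCat.{v} R) ℤ}
    (hP : Module.Projective R (P.X 0)) (hQ : Module.Projective R (Q.X 1))
    (hP0 : IsZero (P.X (-1))) (f : P ⟶ Q) (g : Q ⟶ P) (h : Homotopy (𝟙 Q) (g ≫ f)) :
    Module.Projective R ↥(cokernel (Q.d (-1) 0)) := by
  let gb : cokernel (Q.d (-1) 0) ⟶ P.X 0 := cokernel.desc _ (g.f 0) (by
    rw [← g.comm]; rw [hP0.eq_of_tgt (g.f (-1)) 0, zero_comp])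
  let db : cokernel (Q.d (-1) 0) ⟶ Q.X 1 := cokernel.desc _ (Q.d 0 1) (by simp)
  let p := cokernel.π (Q.d (-1) 0)
  have key : 𝟙 _ = gb ≫ f.f 0 ≫ p + db ≫ h.hom 1 0 ≫ p := by
    rw [← cancel_epi p]
    have hc := h.comm 0
    rw [dNext_eq h.hom (show (ComplexShape.up ℤ).Rel 0 1 by simp),
      prevD_eq h.hom (show (ComplexShape.up ℤ).Rel (-1) 0 by simp)] at hc
    have hc' := congr($hc ≫ p)
    have hp : Q.d (-1) 0 ≫ p = 0 := cokernel.condition _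
    simp only [HomologicalComplex.id_f, HomologicalComplex.comp_f, Preadditive.add_comp,
      Category.assoc, hp, comp_zero, add_zero, Category.id_comp] at hc'
    have h1 : p ≫ gb = g.f 0 := cokernel.π_desc _ _ _
    have h2 : p ≫ db = Q.d 0 1 := cokernel.π_desc _ _ _
    rw [Preadditive.comp_add, reassoc_of% h1, reassoc_of% h2, Category.comp_id, add_comm]
    exact hc'
  refine Module.Projective.of_split (M := P.X 0 × Q.X 1)
    (gb.hom.prod db.hom) ((f.f 0 ≫ p).hom.coprod (h.hom 1 0 ≫ p).hom) ?_
  ext x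
  have := congr(($key).hom x)
  simpa using this.symm

lemma homotopy_aux {R : Type u} [CommRing R] {P Q : CochainComplex (ModuleCat.{v} R) ℤ}
    (d b : ℤ)
    (hPproj : ∀ i, Module.Projective R (P.X i))
    (hQproj : ∀ i, Module.Projective R (Q.X i))
    (hPconc : ∀ i : ℤ, d < i → IsZero (P.X i))
    (hQbdd : ∀ i : ℤ, b < i → IsZero (Q.X i)) (f : P ⟶ Q) [QuasiIso f] :
    Nonempty (HomotopyEquiv P Q) := by
  have : P.IsStrictlyLE d := by rw [CochainComplex.isStrictlyLE_iff]; exact hPconc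
  have : Q.IsStrictlyLE b := by rw [CochainComplex.isStrictlyLE_iff]; exact hQbdd
  have : P.IsKProjective := CochainComplex.isKProjective_of_projective P d
  have : Q.IsKProjective := CochainComplex.isKProjective_of_projective Q b
  obtain ⟨e, -⟩ := (CochainComplex.IsKProjective.quasiIso_iff f).1 inferInstance
  exact ⟨e⟩

lemma trunc_aux {R : Type u} [CommRing R] (Q : CochainComplex (ModuleCat.{v} R) ℤ)
    (hQ : ∀ i : ℤ, i < 0 → IsZero (Q.homology i)) :
    ∃ (Q' : CochainComplex (ModuleCat R) ℤ) (π : Q ⟶ Q')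
      (e₀ : Q'.X 0 ≅ cokernel (Q.d (-1) 0))
      (e : ∀ i : ℤ, 1 ≤ i → (Q'.X i ≅ Q.X i)),
      (∀ i : ℤ, i < 0 → IsZero (Q'.X i)) ∧
      π.f 0 = cokernel.π (Q.d (-1) 0) ≫ e₀.inv ∧
      (∀ (i : ℤ) (hi : 1 ≤ i), π.f i = (e i hi).inv) ∧
      QuasiIso π := by
  let c : Q.opcycles 0 ≅ cokernel (Q.d (-1) 0) :=
    (Q.opcyclesIsCokernel (-1) 0 (by simp)).coconePointUniqueUpToIso (colimit.isColimit _)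
  have hc : cokernel.π (Q.d (-1) 0) ≫ c.inv = Q.pOpcycles 0 :=
    IsColimit.comp_coconePointUniqueUpToIso_inv _ _ WalkingParallelPair.one
  refine ⟨Q.truncGE 0, Q.πTruncGE 0, Q.truncGEXIsoOpcycles 0 ≪≫ c,
    fun i hi => Q.truncGEXIso 0 i (by lia), fun i hi => ?_, ?_, fun i hi => ?_, ?_⟩
  · exact (Q.truncGE 0).isZero_of_isStrictlyGE 0 i hi
  · rw [Iso.trans_inv, reassoc_of% hc]
    dsimp [CochainComplex.πTruncGE, HomologicalComplex.πTruncGE]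
    have hb : (ComplexShape.embeddingUpIntGE 0).BoundaryGE 0 := by
      rw [ComplexShape.boundaryGE_embeddingUpIntGE_iff]
    rw [ComplexShape.Embedding.liftExtend_f _ _ _ (i := 0) (by simp),
      HomologicalComplex.restrictionToTruncGE'_f_eq_iso_hom_pOpcycles_iso_inv _ _
        (i' := 0) (by simp) hb]
    simp [CochainComplex.truncGEXIsoOpcycles, HomologicalComplex.truncGEXIsoOpcycles]
    rfl
  · have hi' : (ComplexShape.embeddingUpIntGE 0).f i.natAbs = i := by
      simp; lia
    have hb : ¬ (ComplexShape.embeddingUpIntGE 0).BoundaryGE i.natAbs := by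
      rw [ComplexShape.boundaryGE_embeddingUpIntGE_iff]; lia
    obtain ⟨n, rfl⟩ := Int.eq_ofNat_of_zero_le (show 0 ≤ i by lia)
    dsimp [CochainComplex.πTruncGE, HomologicalComplex.πTruncGE]
    rw [ComplexShape.Embedding.liftExtend_f _ _ _ hi',
      HomologicalComplex.restrictionToTruncGE'_f_eq_iso_hom_iso_inv _ _ hi' hb]
    simp [CochainComplex.truncGEXIso, HomologicalComplex.truncGEXIso]
    rfl
  · rw [CochainComplex.quasiIso_πTruncGE_iff, CochainComplex.isGE_iff]
    intro i hi
    rw [HomologicalComplex.exactAt_iff_isZero_homology]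
    exact hQ i hi

/-- Let `R` be a commutative ring, `P` a cochain complex of projective `R`-modules
concentrated in degrees `[0, d]`, and `Q` a bounded-above cochain complex of projective
`R`-modules.  If there is a quasi-isomorphism `P → Q` or `Q → P`, then `Hⁱ(Q) = 0` for all
`i < 0`, the cokernel of `d_Q^{-1} : Q^{-1} → Q^0` is projective, and the canonical truncation
`Q' = [coker(d_Q^{-1}) → Q^1 → Q^2 → ⋯]`, together with the canonical projection `Q → Q'`,
is quasi-isomorphic to `Q`.  (The truncation and the projection are characterized by: `Q'`
vanishes in negative degrees, in degree `0` the map is the cokernel projection, and in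
degrees `≥ 1` it is the identity.) -/
theorem truncation_of_projective_complex
    (R : Type*) [CommRing R]
    (d : ℕ) (P Q : CochainComplex (ModuleCat R) ℤ)
    (hPproj : ∀ i, Module.Projective R (P.X i))
    (hQproj : ∀ i, Module.Projective R (Q.X i))
    (hPconc : ∀ i : ℤ, (i < 0 ∨ (d : ℤ) < i) → IsZero (P.X i))
    (hQbdd : ∃ b : ℤ, ∀ i : ℤ, b < i → IsZero (Q.X i))
    (hquasi : (∃ f : P ⟶ Q, QuasiIso f) ∨ (∃ g : Q ⟶ P, QuasiIso g)) :
    (∀ i : ℤ, i < 0 → IsZero (Q.homology i)) ∧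
    Module.Projective R ↥(cokernel (Q.d (-1) 0)) ∧
    ∃ (Q' : CochainComplex (ModuleCat R) ℤ) (π : Q ⟶ Q')
      (e₀ : Q'.X 0 ≅ cokernel (Q.d (-1) 0))
      (e : ∀ i : ℤ, 1 ≤ i → (Q'.X i ≅ Q.X i)),
      (∀ i : ℤ, i < 0 → IsZero (Q'.X i)) ∧
      π.f 0 = cokernel.π (Q.d (-1) 0) ≫ e₀.inv ∧
      (∀ (i : ℤ) (hi : 1 ≤ i), π.f i = (e i hi).inv) ∧
      QuasiIso π := by
  obtain ⟨b, hQbdd⟩ := hQbdd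
  have ⟨e⟩ : Nonempty (HomotopyEquiv P Q) := by
    rcases hquasi with ⟨f, hf⟩ | ⟨f, hf⟩
    · exact homotopy_aux d b hPproj hQproj (fun i hi => hPconc i (Or.inr hi)) hQbdd f
    · exact (homotopy_aux b d hQproj hPproj hQbdd
        (fun i hi => hPconc i (Or.inr hi)) f).map HomotopyEquiv.symm
  have hH : ∀ i : ℤ, i < 0 → IsZero (Q.homology i) := fun i hi => by
    refine IsZero.of_iso ?_ (e.toHomologyIso i).symm
    rw [← HomologicalComplex.exactAt_iff_isZero_homology]
    exact ShortComplex.exact_of_isZero_X₂ _ (hPconc i (Or.inl hi))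
  exact ⟨hH, projective_coker_aux (hPproj 0) (hQproj 1) (hPconc _ (Or.inl (by norm_num)))
    e.hom e.inv e.homotopyInvHomId.symm, trunc_aux Q hH⟩
end

section
/- Let R be a commutative ring. Let P be a cochain complex of flat R-modules concentrated in degrees [0, d] for some d ≥ 0 (that is, Pⁱ = 0 for i < 0 and for i > d), and let Q be a bounded-above cochain complex of flat R-modules. Suppose that there exists a quasi-isomorphism P → Q or a quasi-isomorphism Q → P. Then Hⁱ(Q) = 0 for all i < 0 and the cokernel of the differential d_Q^{−1} : Q^{−1} → Q⁰ is a flat R-module. -/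
open CategoryTheory Limits

theorem Fl_left {R : Type*} [CommRing R] {M N K : Type*} [AddCommGroup M] [AddCommGroup N] [AddCommGroup K]
    [Module R M] [Module R N] [Module R K] (f : M →ₗ[R] N) (g : N →ₗ[R] K)
    (hf : Function.Injective f) (hg : Function.Surjective g) (h : Function.Exact f g)
    [Module.Flat R N] [Module.Flat R K] : Module.Flat R M := by
  rw [Module.Flat.iff_rTensor_injective']
  intro S
  have h1 : Function.Injective (f.lTensor S) :=
    LinearMap.lTensor_injective_of_exact_of_flat g hg f hf h S
  have h2 : Function.Injective (S.subtype.rTensor N) :=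
    Module.Flat.rTensor_preserves_injective_linearMap _ Subtype.val_injective
  refine .of_comp (f := f.lTensor R) ?_
  rw [← LinearMap.coe_comp, LinearMap.lTensor_comp_rTensor, ← LinearMap.rTensor_comp_lTensor,
    LinearMap.coe_comp]
  exact h2.comp h1

theorem Fl_mid {R : Type*} [CommRing R] {M N K : Type*} [AddCommGroup M] [AddCommGroup N] [AddCommGroup K]
    [Module R M] [Module R N] [Module R K] (f : M →ₗ[R] N) (g : N →ₗ[R] K)
    (hf : Function.Injective f) (hg : Function.Surjective g) (h : Function.Exact f g)
    [Module.Flat R M] [Module.Flat R K] : Module.Flat R N := by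
  rw [Module.Flat.iff_rTensor_injective']
  intro S
  have h1 : Function.Injective (f.lTensor R) :=
    LinearMap.lTensor_injective_of_exact_of_flat g hg f hf h R
  have h2 : Function.Injective (S.subtype.rTensor M) :=
    Module.Flat.rTensor_preserves_injective_linearMap _ Subtype.val_injective
  have h3 : Function.Injective (S.subtype.rTensor K) :=
    Module.Flat.rTensor_preserves_injective_linearMap _ Subtype.val_injective
  rw [injective_iff_map_eq_zero]
  intro x hx
  have e1 : g.lTensor S x = 0 := by
    apply h3
    have : (S.subtype.rTensor K ∘ₗ g.lTensor S) x = (g.lTensor R ∘ₗ S.subtype.rTensor N) x := by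
      rw [LinearMap.lTensor_comp_rTensor, LinearMap.rTensor_comp_lTensor]
    rw [LinearMap.comp_apply, LinearMap.comp_apply, hx] at this
    rw [this, map_zero, map_zero]
  obtain ⟨y, rfl⟩ := (lTensor_exact S h hg x).1 e1
  have : (S.subtype.rTensor N ∘ₗ f.lTensor S) y = (f.lTensor R ∘ₗ S.subtype.rTensor M) y := by
    rw [LinearMap.lTensor_comp_rTensor, LinearMap.rTensor_comp_lTensor]
  simp only [LinearMap.comp_apply, hx] at this
  have h4 := h2 (h1 (by simpa using this.symm) : S.subtype.rTensor M y = S.subtype.rTensor M 0)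
  simp [h4]

theorem cone_acyclic {R : Type*} [CommRing R] {P Q : CochainComplex (ModuleCat R) ℤ} (f : P ⟶ Q)
    (hf : QuasiIso f) : (CochainComplex.mappingCone f).Acyclic := by
  rw [← HomotopyCategory.quotient_obj_mem_subcategoryAcyclic_iff_acyclic]
  refine ((HomotopyCategory.subcategoryAcyclic (ModuleCat R)).trW_iff_of_distinguished _
    (HomotopyCategory.mappingCone_triangleh_distinguished f)).1 ?_
  rw [← HomotopyCategory.quasiIso_eq_trW_subcategoryAcyclic]
  exact (HomotopyCategory.quotient_map_mem_quasiIso_iff f).2 hf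

theorem acyc_flat {R : Type*} [CommRing R] (C : CochainComplex (ModuleCat R) ℤ) (hC : C.Acyclic)
    (hfl : ∀ i, Module.Flat R (C.X i)) (b : ℤ) (hb : ∀ i, b < i → IsZero (C.X i)) :
    ∀ (n : ℕ) (i j : ℤ), i + 1 = j → b - n < j →
      Module.Flat R (C.X j ⧸ LinearMap.range (C.d i j).hom) := by
  intro n
  induction n with
  | zero =>
    intro i j hij hj
    have := ModuleCat.subsingleton_of_isZero (hb j (by simpa using hj))
    infer_instance
  | succ n ih =>
    intro i j hij hj
    have hK := ih j (j+1) rfl (by push_cast at hj; linarith)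
    have ex := hC j
    rw [HomologicalComplex.exactAt_iff' _ i j (j+1) (by simp; omega) (by simp),
      ShortComplex.moduleCat_exact_iff_range_eq_ker] at ex
    replace ex : LinearMap.range (C.d i j).hom = LinearMap.ker (C.d j (j+1)).hom := ex
    refine Fl_left (N := C.X (j+1)) (Submodule.liftQ _ (C.d j (j+1)).hom ex.le)
      (LinearMap.range (C.d j (j+1)).hom).mkQ ?_ (Submodule.mkQ_surjective _) ?_
    · rw [← LinearMap.ker_eq_bot]
      exact Submodule.ker_liftQ_eq_bot _ _ _ ex.ge
    · rw [LinearMap.exact_iff, Submodule.ker_mkQ, Submodule.range_liftQ]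

open CochainComplex in
theorem cone_flat {R : Type*} [CommRing R] {P Q : CochainComplex (ModuleCat R) ℤ} (f : P ⟶ Q)
    (hP : ∀ i, Module.Flat R (P.X i)) (hQ : ∀ i, Module.Flat R (Q.X i)) (i : ℤ) :
    Module.Flat R ((mappingCone f).X i) := by
  have := hP (i+1)
  have := hQ i
  let φ : (mappingCone f).X i →ₗ[R] P.X (i+1) × Q.X i :=
    ((mappingCone.fst f).1.v i (i+1) rfl).hom.prod ((mappingCone.snd f).v i i (add_zero i)).hom
  let ψ : P.X (i+1) × Q.X i →ₗ[R] (mappingCone f).X i :=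
    ((mappingCone.inl f).v (i+1) i (by lia)).hom.coprod ((mappingCone.inr f).f i).hom
  have : Module.Flat R (P.X (i+1) × Q.X i) :=
    Fl_mid (LinearMap.inl R (P.X (i+1)) (Q.X i)) (LinearMap.snd R _ _) LinearMap.inl_injective
      LinearMap.snd_surjective .inl_snd
  refine Module.Flat.of_retract φ ψ ?_
  have := congrArg ModuleCat.Hom.hom (mappingCone.id_X f i (i+1) rfl)
  ext x
  simpa [φ, ψ] using LinearMap.congr_fun this x

theorem coker_flat {R : Type*} [CommRing R] {X Y : ModuleCat R} (f : X ⟶ Y)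
    [Module.Flat R (Y ⧸ LinearMap.range f.hom)] : Module.Flat R ↥(cokernel f) :=
  Module.Flat.of_linearEquiv (ModuleCat.cokernelIsoRangeQuotient f).toLinearEquiv

open CochainComplex in
theorem case2 {R : Type*} [CommRing R] {P Q : CochainComplex (ModuleCat R) ℤ} (f : Q ⟶ P)
    (hP : IsZero (P.X (-1)))
    (h : Module.Flat R ((mappingCone f).X (-1) ⧸ LinearMap.range ((mappingCone f).d (-2) (-1)).hom)) :
    Module.Flat R (Q.X 0 ⧸ LinearMap.range (Q.d (-1) 0).hom) := by
  have hP' := ModuleCat.subsingleton_of_isZero hP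
  let e := (mappingCone.fst f).1.v (-1) 0 rfl
  let e' := (mappingCone.inl f).v 0 (-1) rfl
  have h1 : e' ≫ e = 𝟙 _ := by simp [e, e']
  have hd : ∀ x, e ((mappingCone f).d (-2) (-1) x) =
      - Q.d (-1) 0 ((mappingCone.fst f).1.v (-2) (-1) rfl x) := fun x ↦ by
    simpa using! ConcreteCategory.congr_hom (mappingCone.d_fst_v f (-2) (-1) 0 rfl rfl) x
  have hd' : ∀ x, (mappingCone f).d (-2) (-1) ((mappingCone.inl f).v (-1) (-2) rfl x) =
      - e' (Q.d (-1) 0 x) := fun x ↦ by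
    have := ConcreteCategory.congr_hom (mappingCone.inl_v_d f (-1) (-2) 0 rfl rfl) x
    have h0 : f.f (-1) x = 0 := Subsingleton.elim _ _
    simpa [h0] using! this
  refine Module.Flat.of_retract (M := (mappingCone f).X (-1) ⧸ LinearMap.range ((mappingCone f).d (-2) (-1)).hom)
    (Submodule.mapQ _ _ e'.hom ?_) (Submodule.mapQ _ _ e.hom ?_) ?_
  · rintro _ ⟨x, rfl⟩
    refine ⟨-(mappingCone.inl f).v (-1) (-2) rfl x, ?_⟩
    simpa [neg_eq_iff_eq_neg] using! hd' x
  · rintro _ ⟨x, rfl⟩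
    refine ⟨-(mappingCone.fst f).1.v (-2) (-1) rfl x, ?_⟩
    simpa [eq_comm] using! hd x
  · ext x
    have := ConcreteCategory.congr_hom h1 x
    simp at this
    simp [this]

open CochainComplex in
theorem case1 {R : Type*} [CommRing R] {P Q : CochainComplex (ModuleCat R) ℤ} (f : P ⟶ Q)
    (hP : IsZero (P.X (-1))) (hP0 : Module.Flat R (P.X 0))
    (hac : (mappingCone f).Acyclic)
    (h : Module.Flat R ((mappingCone f).X 0 ⧸ LinearMap.range ((mappingCone f).d (-1) 0).hom)) :
    Module.Flat R (Q.X 0 ⧸ LinearMap.range (Q.d (-1) 0).hom) := by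
  have hP' := ModuleCat.subsingleton_of_isZero hP
  have ex := hac (-1)
  rw [HomologicalComplex.exactAt_iff' _ (-2) (-1) 0 (by simp) (by simp),
      ShortComplex.moduleCat_exact_iff] at ex
  -- formulas
  have dinl : ∀ x, (mappingCone f).d (-1) 0 ((mappingCone.inl f).v 0 (-1) rfl x) =
      (mappingCone.inr f).f 0 (f.f 0 x) - (mappingCone.inl f).v 1 0 rfl (P.d 0 1 x) := fun x ↦ by
    simpa using! ConcreteCategory.congr_hom (mappingCone.inl_v_d f 0 (-1) 1 rfl rfl) x
  have dinr : ∀ x, (mappingCone f).d (-1) 0 ((mappingCone.inr f).f (-1) x) =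
      (mappingCone.inr f).f 0 (Q.d (-1) 0 x) := fun x ↦ by
    exact ConcreteCategory.congr_hom (mappingCone.inr_f_d f (-1) 0) x
  have fi : ∀ i j (h : i + 1 = j) x, (mappingCone.fst f).1.v i j h
      ((mappingCone.inl f).v j i (by lia) x) = x := fun i j h x ↦ by
    exact ConcreteCategory.congr_hom (mappingCone.inl_v_fst_v f j i h) x
  have fr : ∀ i j (h : i + 1 = j) x, (mappingCone.fst f).1.v i j h
      ((mappingCone.inr f).f i x) = 0 := fun i j h x ↦ by
    exact ConcreteCategory.congr_hom (mappingCone.inr_f_fst_v f i j h) x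
  have si : ∀ i j (h : j + (-1) = i) x, (mappingCone.snd f).v i i (add_zero i)
      ((mappingCone.inl f).v j i h x) = 0 := fun i j h x ↦ by
    exact ConcreteCategory.congr_hom (mappingCone.inl_v_snd_v f j i h) x
  have sr : ∀ i x, (mappingCone.snd f).v i i (add_zero i)
      ((mappingCone.inr f).f i x) = x := fun i x ↦ by
    exact ConcreteCategory.congr_hom (mappingCone.inr_f_snd_v f i) x
  have dec : ∀ (i j : ℤ) (h : i + 1 = j) x, (mappingCone.inl f).v j i (by clear * - h; omega)
      ((mappingCone.fst f).1.v i j h x) + (mappingCone.inr f).f i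
      ((mappingCone.snd f).v i i (add_zero i) x) = x := fun i j h x ↦ by
    have := congrArg ModuleCat.Hom.hom (mappingCone.id_X f i j h)
    simpa using LinearMap.congr_fun this x
  have dfst : ∀ x, (mappingCone.fst f).1.v (-1) 0 rfl ((mappingCone f).d (-2) (-1) x) = 0 := fun x ↦ by
    have := ConcreteCategory.congr_hom (mappingCone.d_fst_v f (-2) (-1) 0 rfl rfl) x
    have h0 : (mappingCone.fst f).1.v (-2) (-1) rfl x = 0 := Subsingleton.elim _ _
    simpa [h0] using! this
  let B := LinearMap.range (Q.d (-1) 0).hom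
  let BC := LinearMap.range ((mappingCone f).d (-1) 0).hom
  let α : P.X 0 →ₗ[R] P.X 1 × (Q.X 0 ⧸ B) := (-(P.d 0 1).hom).prod (B.mkQ ∘ₗ (f.f 0).hom)
  let β : P.X 1 × (Q.X 0 ⧸ B) →ₗ[R] ((mappingCone f).X 0 ⧸ BC) :=
    (BC.mkQ ∘ₗ ((mappingCone.inl f).v 1 0 rfl).hom).coprod
      (Submodule.mapQ B BC ((mappingCone.inr f).f 0).hom (by
        rintro _ ⟨x, rfl⟩
        exact ⟨_, dinr x⟩))
  have hN : Module.Flat R (P.X 1 × (Q.X 0 ⧸ B)) := by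
    refine Fl_mid α β ?_ ?_ ?_
    · rw [injective_iff_map_eq_zero]
      intro x hx
      have hx1 : P.d 0 1 x = 0 := by simpa [α] using! congrArg Prod.fst hx
      have hx2 : f.f 0 x ∈ B := by
        have := congrArg Prod.snd hx
        exact (Submodule.Quotient.mk_eq_zero B).1 this
      obtain ⟨q, hq⟩ := hx2
      obtain ⟨z, hz⟩ := ex ((mappingCone.inl f).v 0 (-1) rfl x - (mappingCone.inr f).f (-1) q) (by
        refine (map_sub ((mappingCone f).d (-1) 0).hom _ _).trans ?_
        erw [dinl, dinr, hx1, hq]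
        simp
        rfl)
      have := dfst z
      erw [hz, map_sub, fi, fr] at this
      simpa using this
    · intro y
      obtain ⟨y, rfl⟩ := Submodule.mkQ_surjective _ y
      refine ⟨((mappingCone.fst f).1.v 0 1 rfl y, B.mkQ ((mappingCone.snd f).v 0 0 (add_zero 0) y)), ?_⟩
      have := congrArg BC.mkQ (dec 0 1 rfl y)
      simpa [β] using this
    · rintro ⟨p, e⟩
      obtain ⟨q, rfl⟩ := Submodule.mkQ_surjective _ e
      have key : β (p, B.mkQ q) = BC.mkQ ((mappingCone.inl f).v 1 0 rfl p + (mappingCone.inr f).f 0 q) := by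
        simp [β]
      rw [key, Submodule.mkQ_apply, Submodule.Quotient.mk_eq_zero]
      constructor
      · rintro ⟨z, hz⟩
        have hz' : (mappingCone f).d (-1) 0 z = _ := hz
        rw [← dec (-1) 0 rfl z, map_add, dinl, dinr] at hz'
        have h1 := congrArg ((mappingCone.fst f).1.v 0 1 rfl) hz'
        have h2 := congrArg ((mappingCone.snd f).v 0 0 (add_zero 0)) hz'
        simp only [map_add, map_sub, fi, fr, si, sr] at h1 h2
        refine ⟨(mappingCone.fst f).1.v (-1) 0 rfl z, Prod.ext ?_ ?_⟩
        · simpa [α] using! h1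
        · refine (Submodule.Quotient.eq B).2 ⟨-(mappingCone.snd f).v (-1) (-1) (add_zero (-1)) z, ?_⟩
          have h3 : f.f 0 ((mappingCone.fst f).1.v (-1) 0 rfl z) + Q.d (-1) 0 ((mappingCone.snd f).v (-1) (-1) (add_zero (-1)) z) = q := by simpa using h2
          rw [map_neg, ← h3]
          simp
      · rintro ⟨x, hx⟩
        have hx1 : - P.d 0 1 x = p := congrArg Prod.fst hx
        have hx2 : f.f 0 x - q ∈ B := (Submodule.Quotient.eq B).1 (congrArg Prod.snd hx)
        obtain ⟨w, hw⟩ := hx2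
        have hw' : Q.d (-1) 0 w = f.f 0 x - q := hw
        refine ⟨(mappingCone.inl f).v 0 (-1) rfl x - (mappingCone.inr f).f (-1) w, ?_⟩
        refine (map_sub ((mappingCone f).d (-1) 0).hom _ _).trans ?_
        erw [dinl, dinr]
        rw [hw', ← hx1, map_sub, map_neg]
        abel
  exact Module.Flat.of_retract (M := P.X 1 × (Q.X 0 ⧸ B)) (LinearMap.inr R _ _) (LinearMap.snd R _ _) (by ext; simp)

/-- Let `R` be a commutative ring, `P` a cochain complex of flat `R`-modules concentrated in
degrees `[0, d]`, and `Q` a bounded-above cochain complex of flat `R`-modules.  If there is a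
quasi-isomorphism `P → Q` or `Q → P`, then `Hⁱ(Q) = 0` for all `i < 0` and the cokernel of
the differential `d_Q^{-1} : Q^{-1} → Q^0` is a flat `R`-module. -/
theorem flat_cokernel_of_flat_complex
    (R : Type*) [CommRing R]
    (d : ℕ) (P Q : CochainComplex (ModuleCat R) ℤ)
    (hPflat : ∀ i, Module.Flat R (P.X i))
    (hQflat : ∀ i, Module.Flat R (Q.X i))
    (hPconc : ∀ i : ℤ, (i < 0 ∨ (d : ℤ) < i) → IsZero (P.X i))
    (hQbdd : ∃ b : ℤ, ∀ i : ℤ, b < i → IsZero (Q.X i))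
    (hquasi : (∃ f : P ⟶ Q, QuasiIso f) ∨ (∃ g : Q ⟶ P, QuasiIso g)) :
    (∀ i : ℤ, i < 0 → IsZero (Q.homology i)) ∧
    Module.Flat R ↥(cokernel (Q.d (-1) 0)) := by
  obtain ⟨b, hb⟩ := hQbdd
  have hPh : ∀ i : ℤ, i < 0 → IsZero (P.homology i) := fun i hi ↦
    ShortComplex.isZero_homology_of_isZero_X₂ _ (hPconc i (Or.inl hi))
  have hm := hPconc (-1) (Or.inl (by simp))
  have arith : ∀ i : ℤ, max b d - ((max b d - i + 1).toNat : ℤ) < i := fun i ↦ by omega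
  rcases hquasi with ⟨f, hf⟩ | ⟨f, hf⟩
  · refine ⟨fun i hi ↦ (hPh i hi).of_iso (asIso (HomologicalComplex.homologyMap f i)).symm, ?_⟩
    have hac := cone_acyclic f hf
    have := case1 f hm (hPflat 0) hac (acyc_flat _ hac (cone_flat f hPflat hQflat) (max b d)
      (fun i hi ↦ (CochainComplex.mappingCone.isZero_X_iff f i).2
        ⟨hPconc _ (Or.inr (by omega)), hb _ (by omega)⟩) _ (-1) 0 rfl (arith 0))
    exact coker_flat _
  · refine ⟨fun i hi ↦ (hPh i hi).of_iso (asIso (HomologicalComplex.homologyMap f i)), ?_⟩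
    have hac := cone_acyclic f hf
    have := case2 f hm (acyc_flat _ hac (cone_flat f hQflat hPflat) (max b d)
      (fun i hi ↦ (CochainComplex.mappingCone.isZero_X_iff f i).2
        ⟨hb _ (by omega), hPconc _ (Or.inr (by omega))⟩) _ (-2) (-1) rfl (arith (-1)))
    exact coker_flat _
end
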